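/- Let d ≥ 3, α = (d-2)/2, and let P be a homogeneous polynomial of degree l on ℝ^d. Then for every x ∈ ℝ^d, the Fourier transform of the measure P(ξ)dσ(ξ) supported on the unit sphere satisfies ∫_{S^{d-1}} e^{i(x|η)} P(η) dσ(η) = (i/2)^l Σ_{k=0}^{⌊l/2⌋} (-1)^k 2^{2k} Γ(α+1)/Γ(α+l+1-2k) · j_{α+l-2k}(|x|) · h_{l-2k}(P)(x), where h_{l-2k}(P) are the harmonic components of P in its canonical decomposition P = Σ_{k=0}^{⌊l/2⌋} r^{2k} h_{l-2k}(P), given by h_{l-2k}(P) = Σ_{j=0}^{⌊l/2⌋-k} (-1)^j (α+l-2k)Γ(α+l-2k-j)/(4^{k+j} k! j! Γ(α+l+1-k)) r^{2j} Δ^{k+j} P. -/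

import Mathlib

open MeasureTheory MvPolynomial Finset
open scoped RealInnerProductSpace

noncomputable section

/-- The Euclidean Laplacian `Δ = Σ_{j=1}^d ∂²/∂x_j²` acting on polynomials on `ℝ^d`. -/
def lap {d : ℕ} (P : MvPolynomial (Fin d) ℝ) : MvPolynomial (Fin d) ℝ :=
  ∑ i, pderiv i (pderiv i P)

/-- The polynomial `r² = |x|² = Σ_j x_j²` on `ℝ^d`. -/
def r2 (d : ℕ) : MvPolynomial (Fin d) ℝ := ∑ i, X i * X i

/-- The coefficients `e^l_j(k) = (-1)^j (α+l-2k) Γ(α+l-2k-j) / (4^{k+j} k! j! Γ(α+l+1-k))`. -/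
def ecoef (α : ℝ) (l j k : ℕ) : ℝ :=
  (-1) ^ j * (α + l - 2 * k) * Real.Gamma (α + l - 2 * k - j) /
    (4 ^ (k + j) * (Nat.factorial k) * (Nat.factorial j) * Real.Gamma (α + l + 1 - k))

/-- The harmonic component `h_{l-2k}(P) = Σ_{j=0}^{⌊l/2⌋-k} e^l_j(k) r^{2j} Δ^{k+j} P`. -/
def harmComp (d : ℕ) (α : ℝ) (l k : ℕ) (P : MvPolynomial (Fin d) ℝ) :
    MvPolynomial (Fin d) ℝ :=
  ∑ j ∈ Finset.range (l / 2 - k + 1), C (ecoef α l j k) * (r2 d) ^ j * lap^[k + j] P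

/-- The rotation-invariant surface measure on `ℝ^d` (the `(d-1)`-dimensional Hausdorff
measure) normalized so that the unit sphere `S^{d-1}` has total mass `1`. -/
def sphereMeasure (d : ℕ) : Measure (EuclideanSpace ℝ (Fin d)) :=
  (μH[(d : ℝ) - 1] (Metric.sphere (0 : EuclideanSpace ℝ (Fin d)) 1))⁻¹ • μH[(d : ℝ) - 1]

/-- The spherical Bessel function
`j_ν(t) = Γ(ν+1)(t/2)^{-ν} J_ν(t) = Γ(ν+1) Σ_{k=0}^∞ (-1)^k/(Γ(k+1)Γ(k+ν+1)) (t/2)^{2k}`. -/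
def sphericalBesselJ (ν t : ℝ) : ℝ :=
  Real.Gamma (ν + 1) *
    ∑' k : ℕ, (-1) ^ k / (Real.Gamma (k + 1) * Real.Gamma (k + ν + 1)) * (t / 2) ^ (2 * k)

section algebra
variable {d : ℕ}

/-- The Laplacian as a linear map. -/
def lapLin (d : ℕ) : MvPolynomial (Fin d) ℝ →ₗ[ℝ] MvPolynomial (Fin d) ℝ :=
  ∑ i, (pderiv i).toLinearMap ∘ₗ (pderiv i).toLinearMap

lemma lap_eq_lapLin (P : MvPolynomial (Fin d) ℝ) : lap P = lapLin d P := by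
  simp [lap, lapLin]

lemma lap_iter_eq (n : ℕ) (P : MvPolynomial (Fin d) ℝ) : lap^[n] P = (lapLin d ^ n) P := by
  rw [Module.End.pow_apply]
  congr 2
  funext P
  exact lap_eq_lapLin P

lemma lap_add (P Q : MvPolynomial (Fin d) ℝ) : lap (P + Q) = lap P + lap Q := by
  simp [lap_eq_lapLin]

lemma lap_C_mul (c : ℝ) (P : MvPolynomial (Fin d) ℝ) : lap (C c * P) = C c * lap P := by
  simp [lap_eq_lapLin, ← smul_eq_C_mul]

lemma lap_sum {ι : Type*} (s : Finset ι) (f : ι → MvPolynomial (Fin d) ℝ) :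
    lap (∑ i ∈ s, f i) = ∑ i ∈ s, lap (f i) := by
  simp [lap_eq_lapLin]

lemma lap_iter_add (n : ℕ) (P Q : MvPolynomial (Fin d) ℝ) :
    lap^[n] (P + Q) = lap^[n] P + lap^[n] Q := by
  simp [lap_iter_eq]

lemma lap_iter_C_mul (n : ℕ) (c : ℝ) (P : MvPolynomial (Fin d) ℝ) :
    lap^[n] (C c * P) = C c * lap^[n] P := by
  simp [lap_iter_eq, ← smul_eq_C_mul]

lemma lap_iter_zero (n : ℕ) : lap^[n] (0 : MvPolynomial (Fin d) ℝ) = 0 := by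
  simp [lap_iter_eq]

lemma lap_mul (f g : MvPolynomial (Fin d) ℝ) :
    lap (f * g) = lap f * g + f * lap g + 2 * ∑ i, pderiv i f * pderiv i g := by
  simp only [lap, pderiv_mul, map_add, Finset.mul_sum, Finset.sum_mul, ← Finset.sum_add_distrib]
  refine Finset.sum_congr rfl fun i _ => ?_
  ring

lemma lap_homog {q : ℕ} {Q : MvPolynomial (Fin d) ℝ} (h : Q.IsHomogeneous q) :
    (lap Q).IsHomogeneous (q - 2) := by
  refine IsHomogeneous.sum _ _ _ fun i _ => ?_
  have := (h.pderiv (i := i)).pderiv (i := i)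
  rwa [Nat.sub_sub] at this

lemma lap_iter_homog (n : ℕ) {q : ℕ} {Q : MvPolynomial (Fin d) ℝ} (h : Q.IsHomogeneous q) :
    (lap^[n] Q).IsHomogeneous (q - 2 * n) := by
  induction n with
  | zero => simpa using h
  | succ n ih =>
    rw [Function.iterate_succ_apply']
    have := lap_homog ih
    rwa [Nat.sub_sub] at this

lemma pderiv_homog_zero {Q : MvPolynomial (Fin d) ℝ} (h : Q.IsHomogeneous 0) (i : Fin d) :
    pderiv i Q = 0 := by
  obtain ⟨c, rfl⟩ : ∃ c, Q = C c :=
    ⟨_, totalDegree_eq_zero_iff_eq_C.mp (Nat.le_zero.mp h.totalDegree_le)⟩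
  simp

lemma lap_zero_of_le_one {q : ℕ} (hq : q ≤ 1) {Q : MvPolynomial (Fin d) ℝ}
    (h : Q.IsHomogeneous q) : lap Q = 0 := by
  refine Finset.sum_eq_zero fun i _ => pderiv_homog_zero ?_ i
  have := h.pderiv (i := i)
  rwa [show q - 1 = 0 by omega] at this

lemma lap_iter_vanish {n q : ℕ} (hq : q < 2 * n) {Q : MvPolynomial (Fin d) ℝ}
    (h : Q.IsHomogeneous q) : lap^[n] Q = 0 := by
  obtain ⟨n, rfl⟩ : ∃ m, n = m + 1 := ⟨n - 1, by omega⟩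
  rw [Function.iterate_succ_apply']
  exact lap_zero_of_le_one (by omega) (lap_iter_homog n h)

lemma pderiv_comm' (i j : Fin d) (P : MvPolynomial (Fin d) ℝ) :
    pderiv i (pderiv j P) = pderiv j (pderiv i P) := by
  have : ⁅(pderiv i : Derivation ℝ (MvPolynomial (Fin d) ℝ) (MvPolynomial (Fin d) ℝ)),
      (pderiv j : Derivation ℝ (MvPolynomial (Fin d) ℝ) (MvPolynomial (Fin d) ℝ))⁆ = 0 := by
    apply MvPolynomial.derivation_ext
    intro k
    rw [Derivation.commutator_apply]
    by_cases h1 : k = i <;> by_cases h2 : k = j <;> simp [pderiv_X, Pi.single_apply, h1, h2] <;>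
      split_ifs <;> simp
  have h2 := congrArg (fun D => D P) this
  simp only [Derivation.commutator_apply, Derivation.zero_apply] at h2
  exact sub_eq_zero.mp h2

lemma pderiv_r2 (i : Fin d) : pderiv i (r2 d) = 2 * X i := by
  simp only [r2, map_sum, pderiv_mul, pderiv_X]
  simp [Pi.single_apply, Finset.sum_add_distrib]
  ring

lemma lap_r2 : lap (r2 d) = C (2 * (d : ℝ)) := by
  have h2 : ∀ i : Fin d, pderiv i (2 * X i : MvPolynomial (Fin d) ℝ) = C 2 := by
    intro i
    rw [show (2 : MvPolynomial (Fin d) ℝ) = C 2 from rfl, pderiv_C_mul, pderiv_X_self, mul_one]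
  simp only [lap, pderiv_r2, h2]
  simp [mul_comm]

lemma r2_homog : (r2 d).IsHomogeneous 2 :=
  IsHomogeneous.sum _ _ _ fun i _ => (isHomogeneous_X ℝ i).mul (isHomogeneous_X ℝ i)

lemma lap_r2_mul {q : ℕ} {Q : MvPolynomial (Fin d) ℝ} (h : Q.IsHomogeneous q) :
    lap (r2 d * Q) = C (2 * (d : ℝ) + 4 * q) * Q + r2 d * lap Q := by
  rw [lap_mul, lap_r2]
  simp only [pderiv_r2]
  have : ∑ i, 2 * X i * pderiv i Q = 2 * (q • Q) := by
    rw [← h.sum_X_mul_pderiv, Finset.mul_sum]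
    simp only [mul_assoc]
  rw [this, nsmul_eq_mul, show (2 * (d : ℝ) + 4 * q) = 2 * (d : ℝ) + (4 * q : ℕ) by push_cast; ring,
    C_add, map_natCast]
  push_cast
  ring

lemma lap_r2_pow_mul {q : ℕ} {Q : MvPolynomial (Fin d) ℝ} (h : Q.IsHomogeneous q) (j : ℕ) :
    lap (r2 d ^ (j + 1) * Q) =
      C (((j : ℝ) + 1) * (4 * j + 4 * q + 2 * d)) * (r2 d ^ j * Q) + r2 d ^ (j + 1) * lap Q := by
  induction j with
  | zero =>
    rw [zero_add, pow_one, lap_r2_mul h]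
    congr 2 <;> simp [add_comm]
  | succ j ih =>
    rw [pow_succ', mul_assoc, lap_r2_mul ((r2_homog.pow (j + 1)).mul h), ih]
    have : (((j + 1 : ℕ) : ℝ) + 1) * (4 * (j + 1 : ℕ) + 4 * q + 2 * d) =
      (2 * (d : ℝ) + 4 * (2 * (j + 1) + q : ℕ)) + ((j : ℝ) + 1) * (4 * j + 4 * q + 2 * d) := by
      push_cast; ring
    rw [this]
    generalize (2 * (d : ℝ) + 4 * (2 * (j + 1) + q : ℕ)) = A
    generalize ((j : ℝ) + 1) * (4 * j + 4 * q + 2 * d) = B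
    rw [C_add]
    ring

lemma lap_iter_r2_pow (M : ℕ) :
    lap^[M] (r2 d ^ M) = C (∏ j ∈ Finset.range M, ((j : ℝ) + 1) * (4 * j + 2 * d)) := by
  induction M with
  | zero => simp
  | succ M ih =>
    have := lap_r2_pow_mul (d := d) (isHomogeneous_one (Fin d) ℝ) M
    have h1 : lap (1 : MvPolynomial (Fin d) ℝ) = 0 := by
      exact lap_zero_of_le_one zero_le_one (isHomogeneous_one _ _)
    rw [Function.iterate_succ_apply, ← mul_one (r2 d ^ (M + 1)), this, h1, mul_zero, add_zero,
      mul_one, lap_iter_C_mul, ih, Finset.prod_range_succ, ← C_mul]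
    congr 1
    push_cast
    ring

/-- The linear form `(x|·)` as a polynomial. -/
def lin (x : Fin d → ℝ) : MvPolynomial (Fin d) ℝ := ∑ i, C (x i) * X i

/-- The directional derivative along `x`. -/
def Dx (x : Fin d → ℝ) (H : MvPolynomial (Fin d) ℝ) : MvPolynomial (Fin d) ℝ :=
  ∑ i, C (x i) * pderiv i H

lemma pderiv_lin (x : Fin d → ℝ) (i : Fin d) : pderiv i (lin x) = C (x i) := by
  simp [lin, map_sum, pderiv_X, Pi.single_apply]

lemma Dx_homog (x : Fin d → ℝ) {m : ℕ} {H : MvPolynomial (Fin d) ℝ} (h : H.IsHomogeneous m) :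
    (Dx x H).IsHomogeneous (m - 1) :=
  IsHomogeneous.sum _ _ _ fun i _ => by
    simpa using (isHomogeneous_C _ (x i)).mul (h.pderiv (i := i))

lemma Dx_harm (x : Fin d → ℝ) {H : MvPolynomial (Fin d) ℝ} (h : lap H = 0) :
    lap (Dx x H) = 0 := by
  rw [Dx, lap_sum]
  refine Finset.sum_eq_zero fun i _ => ?_
  rw [lap_C_mul]
  have : lap (pderiv i H) = pderiv i (lap H) := by
    simp only [lap, map_sum]
    refine Finset.sum_congr rfl fun j _ => ?_
    rw [pderiv_comm' j i, pderiv_comm' j i]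
  rw [this, h, map_zero, mul_zero]

lemma eval_Dx (x : Fin d → ℝ) {m : ℕ} {H : MvPolynomial (Fin d) ℝ} (h : H.IsHomogeneous m) :
    eval x (Dx x H) = m * eval x H := by
  have := congrArg (eval x) h.sum_X_mul_pderiv
  simpa [Dx] using this

lemma lap_lin_pow (x : Fin d → ℝ) (a : ℕ) :
    lap (lin x ^ a) = C ((a : ℝ) * (a - 1 : ℕ) * ∑ i, x i ^ 2) * lin x ^ (a - 2) := by
  simp only [lap, pderiv_pow, pderiv_lin, pderiv_mul, Derivation.map_natCast, pderiv_C]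
  rw [Finset.mul_sum, map_sum, Finset.sum_mul]
  refine Finset.sum_congr rfl fun i _ => ?_
  simp [Nat.sub_sub]
  ring

lemma lap_lin_pow_mul (x : Fin d → ℝ) (a : ℕ) {H : MvPolynomial (Fin d) ℝ} (h : lap H = 0) :
    lap (lin x ^ a * H) = C ((a : ℝ) * (a - 1 : ℕ) * ∑ i, x i ^ 2) * (lin x ^ (a - 2) * H) +
      C (2 * (a : ℝ)) * (lin x ^ (a - 1) * Dx x H) := by
  rw [lap_mul, lap_lin_pow, h, mul_zero, add_zero, mul_assoc]
  congr 1
  simp only [Dx, pderiv_pow, pderiv_lin, Finset.mul_sum]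
  refine Finset.sum_congr rfl fun i _ => ?_
  simp [C_mul]
  rw [show (C 2 : MvPolynomial (Fin d) ℝ) = 2 from rfl]
  ring

lemma lap_iter_lin_pow_mul (x : Fin d → ℝ) (M : ℕ) : ∀ (a m : ℕ) (_ : a + m = 2 * M)
    (H : MvPolynomial (Fin d) ℝ) (_ : lap H = 0) (_ : H.IsHomogeneous m),
    lap^[M] (lin x ^ a * H) = C ((M.choose m : ℝ) * a.factorial * 2 ^ m * (∑ i, x i ^ 2) ^ (M - m) *
      m.factorial * eval x H) := by
  induction M with
  | zero =>
    intro a m ham H h1 h2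
    obtain ⟨rfl, rfl⟩ : a = 0 ∧ m = 0 := by omega
    obtain ⟨c, rfl⟩ : ∃ c, H = C c :=
      ⟨_, totalDegree_eq_zero_iff_eq_C.mp (Nat.le_zero.mp h2.totalDegree_le)⟩
    simp
  | succ M ih =>
    intro a m ham H h1 h2
    rw [Function.iterate_succ_apply, lap_lin_pow_mul x a h1, lap_iter_add, lap_iter_C_mul,
      lap_iter_C_mul]
    have hS : C ((a : ℝ) * (a - 1 : ℕ) * ∑ i, x i ^ 2) * lap^[M] (lin x ^ (a - 2) * H) =
        C ((M.choose m : ℝ) * a.factorial * 2 ^ m * (∑ i, x i ^ 2) ^ (M + 1 - m) *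
          m.factorial * eval x H) := by
      rcases a with _ | _ | a
      · rw [Nat.choose_eq_zero_of_lt (by omega)]; simp
      · rw [Nat.choose_eq_zero_of_lt (by omega)]; simp
      · rw [show a + 1 + 1 - 2 = a by omega, ih a m (by omega) H h1 h2, ← C_mul]
        congr 1
        by_cases hm : m ≤ M
        · rw [Nat.succ_sub hm, pow_succ, Nat.factorial_succ, Nat.factorial_succ]
          push_cast [Nat.add_sub_cancel]
          ring
        · rw [Nat.choose_eq_zero_of_lt (by omega)]; simp
    rw [hS]
    rcases m with _ | m
    · have : Dx x H = 0 := Finset.sum_eq_zero fun i _ => by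
        rw [pderiv_homog_zero h2, mul_zero]
      rw [this, mul_zero, lap_iter_zero]
      simp
    · rcases a with _ | a
      · rw [Nat.choose_eq_zero_of_lt (by omega), Nat.choose_eq_zero_of_lt (by omega)]; simp
      · rw [Nat.add_sub_cancel, ih a m (by omega) _ (Dx_harm x h1) (Dx_homog x h2),
          eval_Dx x h2, ← C_mul, ← C_add, Nat.choose_succ_succ, Nat.add_sub_add_right]
        congr 1
        rw [Nat.factorial_succ, Nat.factorial_succ]
        push_cast
        ring

lemma lap_iter_lin_pow (x : Fin d → ℝ) (M : ℕ) :
    lap^[M] (lin x ^ (2 * M)) = C (((2 * M).factorial : ℝ) * (∑ i, x i ^ 2) ^ M) := by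
  have := lap_iter_lin_pow_mul x M (2 * M) 0 rfl 1
    (lap_zero_of_le_one zero_le_one (isHomogeneous_one _ _)) (isHomogeneous_one _ _)
  simpa using this

/-- A linear functional killing all `n`-th powers of linear forms kills all homogeneous
polynomials of degree `n`. -/
lemma functional_zero (L : MvPolynomial (Fin d) ℝ →ₗ[ℝ] ℝ) (n : ℕ)
    (h : ∀ x : Fin d → ℝ, L (lin x ^ n) = 0) {Q : MvPolynomial (Fin d) ℝ}
    (hQ : Q.IsHomogeneous n) : L Q = 0 := by
  classical
  set p : MvPolynomial (Fin d) ℝ := ∑ k ∈ Finset.piAntidiag Finset.univ n,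
    monomial (Finsupp.equivFunOnFinite.symm k)
      ((Nat.multinomial Finset.univ k : ℝ) *
        L (monomial (Finsupp.equivFunOnFinite.symm k) 1)) with hp
  have hp0 : p = 0 := by
    apply MvPolynomial.funext
    intro x
    rw [map_zero, ← h x, lin, Finset.sum_pow_eq_sum_piAntidiag, hp, map_sum, map_sum]
    refine Finset.sum_congr rfl fun k _ => ?_
    rw [eval_monomial]
    have : (Nat.multinomial Finset.univ k : MvPolynomial (Fin d) ℝ) *
        ∏ i, (C (x i) * X i) ^ k i = ((Nat.multinomial Finset.univ k : ℝ) * ∏ i, x i ^ k i) •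
          monomial (Finsupp.equivFunOnFinite.symm k) 1 := by
      rw [smul_eq_C_mul, C_mul, map_natCast, monomial_eq, Finsupp.prod_fintype _ _ (by simp)]
      simp [mul_pow, Finset.prod_mul_distrib, mul_assoc, map_prod]
    rw [this, map_smul, Finsupp.prod_fintype _ _ (by simp)]
    simp
    ring
  rw [Q.as_sum, map_sum]
  refine Finset.sum_eq_zero fun β hβ => ?_
  have hβ' := hQ (mem_support_iff.mp hβ)
  have hc := congrArg (coeff β) hp0
  rw [hp, coeff_sum, Finset.sum_eq_single (⇑β)] at hc
  · simp only [coeff_monomial, coeff_zero, Finsupp.equivFunOnFinite_symm_coe, if_true] at hc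
    have h1 : (Nat.multinomial Finset.univ (⇑β) : ℝ) ≠ 0 := by
      exact_mod_cast (Nat.multinomial_pos _ _).ne'
    have h2 := (mul_eq_zero.mp hc).resolve_left h1
    rw [show monomial β (coeff β Q) = coeff β Q • monomial β (1 : ℝ) by simp [smul_monomial],
      map_smul, h2, smul_zero]
  · intro k _ hk
    rw [coeff_monomial, if_neg]
    rintro rfl
    exact hk (by simp)
  · intro hn
    exfalso
    apply hn
    rw [Finset.mem_piAntidiag]
    refine ⟨?_, by simp⟩
    rw [← hβ', Finsupp.weight_apply, Finsupp.sum_fintype _ _ (by simp)]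
    simp

end algebra
section decomp
variable {d : ℕ}

lemma ecoef_rec {α : ℝ} (hα0 : 0 < α) {l j k : ℕ} (h : 2 * k + 2 * j + 2 ≤ l) :
    ecoef α l (j + 1) k * (((j : ℝ) + 1) * (4 * (α + l - 2 * k - j - 1))) + ecoef α l j k = 0 := by
  have h' : 2 * (k : ℝ) + 2 * j + 2 ≤ l := by exact_mod_cast h
  have hj : (0 : ℝ) ≤ j := Nat.cast_nonneg j
  have hk : (0 : ℝ) ≤ k := Nat.cast_nonneg k
  have hpos : 0 < α + l - 2 * k - j - 1 := by linarith
  have hG : Real.Gamma (α + l - 2 * k - j) =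
      (α + l - 2 * k - j - 1) * Real.Gamma (α + l - 2 * k - j - 1) := by
    rw [← Real.Gamma_add_one hpos.ne']; congr 1; ring
  have hG2 : Real.Gamma (α + l + 1 - k) ≠ 0 := (Real.Gamma_pos_of_pos (by linarith)).ne'
  have hf : (j.factorial : ℝ) ≠ 0 := by positivity
  have hf' : (k.factorial : ℝ) ≠ 0 := by positivity
  simp only [ecoef, hG, Nat.factorial_succ]
  push_cast
  rw [show α + l - 2 * k - (j + 1 : ℝ) = α + l - 2 * k - j - 1 by ring]
  field_simp
  ring

lemma ecoef_sum {α : ℝ} (hα0 : 0 < α) {l t m : ℕ} (h : 2 * (t + 1) ≤ l) (hm : m ≤ t + 1) :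
    ∑ k ∈ Finset.range (m + 1), ecoef α l (t + 1 - k) k =
      (-1) ^ (t + 1 + m) * (t.choose m) * Real.Gamma (α + l - m - (t + 1)) /
        (Real.Gamma (α + l - m) * 4 ^ (t + 1) * (t + 1).factorial) := by
  have h' : 2 * ((t : ℝ) + 1) ≤ l := by exact_mod_cast h
  have ht : (0 : ℝ) ≤ t := Nat.cast_nonneg t
  induction m with
  | zero =>
    have hG : Real.Gamma (α + l + 1) = (α + l) * Real.Gamma (α + l) :=
      Real.Gamma_add_one (by linarith)
    have hp : α + l ≠ 0 := by linarith
    simp [ecoef, hG]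
    field_simp
  | succ m ih =>
    have hm' : (m : ℝ) + 1 ≤ t + 1 := by exact_mod_cast hm
    have hm0 : (0 : ℝ) ≤ m := Nat.cast_nonneg m
    rw [Finset.sum_range_succ, ih (by omega)]
    have hp1 : 0 < α + l - m - 1 - (t + 1) := by linarith
    have hp2 : 0 < α + l - m - 1 := by linarith
    have hG1 : Real.Gamma (α + l - m - (t + 1)) =
        (α + l - m - 1 - (t + 1)) * Real.Gamma (α + l - m - 1 - (t + 1)) := by
      rw [← Real.Gamma_add_one hp1.ne']; congr 1; ring
    have hG2 : Real.Gamma (α + l - m) = (α + l - m - 1) * Real.Gamma (α + l - m - 1) := by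
      rw [← Real.Gamma_add_one hp2.ne']; congr 1; ring
    have hG3 := (Real.Gamma_pos_of_pos hp2).ne'
    have hch : ((t + 1).choose (m + 1) : ℝ) * ((m + 1).factorial * (t - m).factorial) =
        (t + 1).factorial := by
      have := Nat.choose_mul_factorial_mul_factorial hm
      rw [Nat.add_sub_add_right] at this
      rw [← this]; push_cast; ring
    have hch1 : ((t + 1).choose (m + 1) : ℝ) = t.choose m + t.choose (m + 1) := by
      exact_mod_cast Nat.choose_succ_succ t m
    have hch2 : (t.choose (m + 1) : ℝ) * (m + 1) = t.choose m * (t - m) := by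
      have := Nat.choose_succ_right_eq t m
      rw [← Nat.cast_sub (by omega)]
      exact_mod_cast this
    have hs : (-1 : ℝ) ^ (t + 1 + (m + 1)) = (-1) ^ (t - m) := by
      rw [show t + 1 + (m + 1) = t - m + 2 * (m + 1) by omega, pow_add, pow_mul]; simp
    have hs' : (-1 : ℝ) ^ (t + 1 + m) = - (-1) ^ (t - m) := by
      rw [← hs, ← add_assoc, pow_succ]; ring
    have hf1 : ((m + 1).factorial : ℝ) ≠ 0 := by positivity
    have hf2 : ((t - m).factorial : ℝ) ≠ 0 := by positivity
    have hf3 : ((t + 1).choose (m + 1) : ℝ) ≠ 0 := by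
      exact_mod_cast (Nat.choose_pos hm).ne'
    have he : ecoef α l (t + 1 - (m + 1)) (m + 1) = (-1) ^ (t - m) * (α + l - 2 * (m + 1)) *
        ((t + 1).choose (m + 1) : ℝ) * Real.Gamma (α + l - m - 1 - (t + 1)) /
        (Real.Gamma (α + l - m) * 4 ^ (t + 1) * (t + 1).factorial) := by
      rw [Nat.add_sub_add_right, ecoef, ← hch,
        show m + 1 + (t - m) = t + 1 by omega, Nat.cast_sub (by omega)]
      push_cast
      rw [show α + l + 1 - (m + 1 : ℝ) = α + l - m by ring,
        show α + l - 2 * (m + 1) - (t - m : ℝ) = α + l - m - 1 - (t + 1) by ring, hG2]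
      field_simp
    rw [he, hs, hs', hG1, hG2, hch1]
    push_cast
    rw [show α + l - (m + 1 : ℝ) = α + l - m - 1 by ring]
    field_simp
    have e1 : (t.choose (m + 1) : ℝ) * m = t.choose m * (t - m) - t.choose (m + 1) := by
      linarith
    linear_combination (-1 : ℝ) * hch2

lemma ecoef_sum_eq {α : ℝ} (hα0 : 0 < α) {l s : ℕ} (h : 2 * s ≤ l) :
    ∑ k ∈ Finset.range (s + 1), ecoef α l (s - k) k = if s = 0 then 1 else 0 := by
  rcases s with _ | t
  · have hp : 0 < α + l := by positivity
    have := (Real.Gamma_pos_of_pos hp).ne'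
    simp [ecoef, Real.Gamma_add_one hp.ne']
    exact ⟨hp.ne', this⟩
  · rw [ecoef_sum hα0 h le_rfl, Nat.choose_eq_zero_of_lt (Nat.lt_succ_self t)]
    simp

lemma harmComp_sum {α : ℝ} (hα0 : 0 < α) (l : ℕ) (P : MvPolynomial (Fin d) ℝ) :
    ∑ k ∈ Finset.range (l / 2 + 1), r2 d ^ k * harmComp d α l k P = P := by
  have h1 : ∀ k ∈ Finset.range (l / 2 + 1), r2 d ^ k * harmComp d α l k P =
      ∑ j ∈ Finset.range (l / 2 + 1 - k),
        C (ecoef α l j k) * (r2 d ^ (k + j) * lap^[k + j] P) := by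
    intro k hk
    rw [Finset.mem_range] at hk
    rw [harmComp, Finset.mul_sum, show l / 2 - k + 1 = l / 2 + 1 - k by omega]
    refine Finset.sum_congr rfl fun j _ => ?_
    rw [pow_add]; ring
  rw [Finset.sum_congr rfl h1, ← Finset.sum_range_diag_flip (l / 2 + 1)
    (fun k j => C (ecoef α l j k) * (r2 d ^ (k + j) * lap^[k + j] P))]
  have h2 : ∀ s ∈ Finset.range (l / 2 + 1), ∑ k ∈ Finset.range (s + 1),
      C (ecoef α l (s - k) k) * (r2 d ^ (k + (s - k)) * lap^[k + (s - k)] P) =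
      if s = 0 then P else 0 := by
    intro s hs
    rw [Finset.mem_range] at hs
    have h3 : ∀ k ∈ Finset.range (s + 1),
        C (ecoef α l (s - k) k) * (r2 d ^ (k + (s - k)) * lap^[k + (s - k)] P) =
        C (ecoef α l (s - k) k) * (r2 d ^ s * lap^[s] P) := by
      intro k hk
      rw [Finset.mem_range] at hk
      rw [show k + (s - k) = s by omega]
    rw [Finset.sum_congr rfl h3, ← Finset.sum_mul, ← map_sum, ecoef_sum_eq hα0 (by omega)]
    split_ifs with h
    · subst h; simp
    · simp
  rw [Finset.sum_congr rfl h2]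
  simp

lemma harmComp_harm {α : ℝ} (hα0 : 0 < α) (hα : α = ((d : ℝ) - 2) / 2) {l k : ℕ} (hk : k ≤ l / 2)
    {P : MvPolynomial (Fin d) ℝ} (hP : P.IsHomogeneous l) : lap (harmComp d α l k P) = 0 := by
  have key : ∀ n ≤ l / 2 - k, lap (∑ j ∈ Finset.range (n + 1),
      C (ecoef α l j k) * (r2 d) ^ j * lap^[k + j] P) =
      C (ecoef α l n k) * (r2 d ^ n * lap^[k + n + 1] P) := by
    intro n hn
    induction n with
    | zero => simp [lap_C_mul, Function.iterate_succ_apply']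
    | succ n ih =>
      rw [Finset.sum_range_succ, lap_add, ih (by omega), mul_assoc, lap_C_mul,
        lap_r2_pow_mul (lap_iter_homog (k + (n + 1)) hP), Function.iterate_succ_apply' lap (k+(n+1)),
        mul_add, ← add_assoc, ← mul_assoc (C _) (C _), ← C_mul, ← add_assoc k, ← add_mul, ← C_add]
      have hc : ecoef α l n k + ecoef α l (n + 1) k *
          (((n : ℝ) + 1) * (4 * n + 4 * (l - 2 * (k + n + 1) : ℕ) + 2 * d)) = 0 := by
        rw [← ecoef_rec hα0 (show 2 * k + 2 * n + 2 ≤ l by omega), add_comm,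
          Nat.cast_sub (by omega)]
        push_cast
        rw [show (d : ℝ) = 2 * α + 2 by rw [hα]; ring]
        ring
      rw [hc]
      simp
  rw [harmComp, key _ le_rfl, show k + (l / 2 - k) + 1 = l / 2 + 1 by omega,
    lap_iter_vanish (by omega) hP]
  simp

lemma harmComp_homog {α : ℝ} {l k : ℕ} (hk : k ≤ l / 2)
    {P : MvPolynomial (Fin d) ℝ} (hP : P.IsHomogeneous l) :
    (harmComp d α l k P).IsHomogeneous (l - 2 * k) := by
  refine IsHomogeneous.sum _ _ _ fun j hj => ?_
  rw [Finset.mem_range] at hj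
  have := ((isHomogeneous_C (Fin d) (ecoef α l j k)).mul (r2_homog.pow j)).mul
    (lap_iter_homog (k + j) hP)
  rwa [show 0 + 2 * j + (l - 2 * (k + j)) = l - 2 * k by omega] at this

end decomp
section measure

lemma sphere_hausdorff_ne_zero (n : ℕ) :
    μH[(n : ℝ)] (Metric.sphere (0 : EuclideanSpace ℝ (Fin (n + 1))) 1) ≠ 0 := by
  set f : EuclideanSpace ℝ (Fin (n + 1)) → (Fin n → ℝ) := fun η i => η i.succ with hf
  have hlip : LipschitzWith 1 f := by
    refine LipschitzWith.of_dist_le_mul fun x y => ?_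
    rw [NNReal.coe_one, one_mul, dist_pi_le_iff dist_nonneg]
    intro i
    rw [dist_eq_norm, dist_eq_norm]
    exact PiLp.norm_apply_le (x - y) i.succ
  have hsub : Set.pi Set.univ (fun _ : Fin n => Set.Icc (0 : ℝ) (1 / (n + 1))) ⊆
      f '' Metric.sphere (0 : EuclideanSpace ℝ (Fin (n + 1))) 1 := by
    intro y hy
    have hy' : ∀ i, 0 ≤ y i ∧ y i ≤ 1 / (n + 1) := fun i => hy i (Set.mem_univ i)
    have hsum : ∑ i, y i ^ 2 ≤ 1 := by
      have : ∀ i ∈ Finset.univ, y i ^ 2 ≤ 1 / ((n : ℝ) + 1) := by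
        intro i _
        have h1 : 1 / ((n : ℝ) + 1) ≤ 1 := by
          rw [div_le_one (by positivity)]; linarith [Nat.cast_nonneg (α := ℝ) n]
        nlinarith [hy' i]
      refine (Finset.sum_le_sum this).trans ?_
      simp
      rw [← div_eq_mul_inv, div_le_one (by positivity)]
      linarith
    refine ⟨WithLp.toLp 2 (Fin.cons (Real.sqrt (1 - ∑ i, y i ^ 2)) y), ?_, ?_⟩
    · rw [mem_sphere_zero_iff_norm, EuclideanSpace.norm_eq, Real.sqrt_eq_one, Fin.sum_univ_succ]
      simp [Real.sq_sqrt (sub_nonneg.mpr hsum)]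
    · funext i
      simp [hf]
  intro h0
  have h1 := hlip.hausdorffMeasure_image_le (d := (n : ℝ)) (Nat.cast_nonneg n)
    (Metric.sphere (0 : EuclideanSpace ℝ (Fin (n + 1))) 1)
  rw [h0, mul_zero, nonpos_iff_eq_zero] at h1
  have h2 := measure_mono_null hsub h1
  have h3 : (μH[(n : ℝ)] : Measure (Fin n → ℝ)) = volume := by
    have := hausdorffMeasure_pi_real (ι := Fin n)
    simpa using this
  rw [h3, volume_pi_pi] at h2
  simp only [Real.volume_Icc, Finset.prod_const] at h2
  have h5 : ENNReal.ofReal (1 / ((n : ℝ) + 1) - 0) ≠ 0 := by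
    rw [sub_zero, Ne, ENNReal.ofReal_eq_zero, not_le]; positivity
  exact pow_ne_zero _ h5 h2

lemma normalize_lipschitz {E : Type*} [NormedAddCommGroup E] [NormedSpace ℝ E] :
    LipschitzOnWith 2 (fun v : E => ‖v‖⁻¹ • v) {v | 1 ≤ ‖v‖} := by
  refine LipschitzOnWith.of_dist_le_mul fun x hx y hy => ?_
  simp only [Set.mem_ofPred_eq] at hx hy
  have hx0 : 0 < ‖x‖ := by linarith
  have hy0 : 0 < ‖y‖ := by linarith
  rw [dist_eq_norm, dist_eq_norm]
  have : ‖x‖⁻¹ • x - ‖y‖⁻¹ • y = ‖x‖⁻¹ • ((x - y) + ((‖y‖ - ‖x‖) * ‖y‖⁻¹) • y) := by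
    rw [smul_add, smul_sub, smul_smul,
      show ‖x‖⁻¹ * ((‖y‖ - ‖x‖) * ‖y‖⁻¹) = ‖x‖⁻¹ - ‖y‖⁻¹ by field_simp, sub_smul]
    abel
  rw [this, norm_smul, norm_inv, norm_norm]
  have h1 : ‖((‖y‖ - ‖x‖) * ‖y‖⁻¹) • y‖ ≤ ‖x - y‖ := by
    rw [norm_smul, norm_mul, norm_inv, norm_norm, mul_assoc, inv_mul_cancel₀ hy0.ne', mul_one,
      norm_sub_rev x y]
    exact abs_norm_sub_norm_le y x
  have h2 := norm_add_le (x - y) (((‖y‖ - ‖x‖) * ‖y‖⁻¹) • y)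
  have h3 : ‖x‖⁻¹ ≤ 1 := inv_le_one_of_one_le₀ hx
  calc _ ≤ 1 * (‖x - y‖ + ‖x - y‖) := by gcongr; linarith
    _ = _ := by push_cast; ring

lemma sphere_hausdorff_ne_top (n : ℕ) :
    μH[(n : ℝ)] (Metric.sphere (0 : EuclideanSpace ℝ (Fin (n + 1))) 1) ≠ ⊤ := by
  set K : Set (Fin n → ℝ) := Set.pi Set.univ (fun _ : Fin n => Set.Icc (-1 : ℝ) 1) with hK
  set g : Fin (n + 1) × Bool → (Fin n → ℝ) → EuclideanSpace ℝ (Fin (n + 1)) :=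
    fun p y => WithLp.toLp 2 (Fin.insertNth p.1 (if p.2 then (1 : ℝ) else -1) y) with hg
  have hcover : Metric.sphere (0 : EuclideanSpace ℝ (Fin (n + 1))) 1 ⊆
      ⋃ p, (fun v => ‖v‖⁻¹ • v) '' (g p '' K) := by
    intro η hη
    rw [mem_sphere_zero_iff_norm] at hη
    obtain ⟨i, -, hi⟩ := Finset.exists_max_image Finset.univ (fun i => |η i|) ⟨0, Finset.mem_univ _⟩
    have hne : η i ≠ 0 := by
      intro h0
      have : η = 0 := by
        ext j
        have := hi j (Finset.mem_univ _)
        rw [h0, abs_zero] at this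
        simpa using this
      rw [this] at hη
      simp at hη
    have hpos : 0 < |η i| := abs_pos.mpr hne
    refine Set.mem_iUnion.mpr ⟨(i, decide (0 < η i)), ?_⟩
    refine ⟨|η i|⁻¹ • η, ⟨fun j => |η i|⁻¹ * η (i.succAbove j), ?_, ?_⟩, ?_⟩
    · intro j _
      rw [Set.mem_Icc, ← abs_le, abs_mul, abs_inv, abs_abs, inv_mul_le_one₀ hpos]
      exact hi _ (Finset.mem_univ _)
    · ext j
      refine Fin.succAboveCases i ?_ (fun j => ?_) j
      · simp only [hg, decide_eq_true_eq, PiLp.smul_apply, smul_eq_mul, Fin.insertNth_apply_same]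
        split_ifs with h
        · rw [abs_of_pos h, inv_mul_cancel₀ hne]
        · have : η i < 0 := lt_of_le_of_ne (not_lt.mp h) hne
          rw [abs_of_neg this]; field_simp
      · simp [hg]
    · simp only [norm_smul, hη, norm_inv, Real.norm_eq_abs, abs_abs, mul_one, inv_inv, smul_smul]
      rw [mul_inv_cancel₀ hpos.ne', one_smul]
  have hfin : ∀ p, μH[(n : ℝ)] ((fun v => ‖v‖⁻¹ • v) '' (g p '' K)) < ⊤ := by
    intro p
    have hlip1 : LipschitzWith 1 (fun y : Fin n → ℝ =>
        (Fin.insertNth p.1 (if p.2 then (1 : ℝ) else -1) y : Fin (n + 1) → ℝ)) := by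
      refine LipschitzWith.of_dist_le_mul fun x y => ?_
      rw [NNReal.coe_one, one_mul, dist_pi_le_iff dist_nonneg]
      intro j
      refine Fin.succAboveCases p.1 ?_ (fun j => ?_) j
      · simp
      · simpa using dist_le_pi_dist x y j
    have hlip2 := (PiLp.lipschitzWith_toLp 2 (fun _ : Fin (n + 1) => ℝ)).comp hlip1
    have hlip3 : LipschitzOnWith 2 (fun v : EuclideanSpace ℝ (Fin (n + 1)) => ‖v‖⁻¹ • v)
        (g p '' K) := by
      refine normalize_lipschitz.mono ?_
      rintro _ ⟨y, -, rfl⟩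
      have := PiLp.norm_apply_le (g p y) p.1
      refine le_trans ?_ this
      simp only [hg, Fin.insertNth_apply_same]
      split_ifs <;> simp
    have hm1 := hlip2.hausdorffMeasure_image_le (d := (n : ℝ)) (Nat.cast_nonneg n) K
    have hm2 := hlip3.hausdorffMeasure_image_le (d := (n : ℝ)) (Nat.cast_nonneg n)
    have h3 : (μH[(n : ℝ)] : Measure (Fin n → ℝ)) = volume := by
      have := hausdorffMeasure_pi_real (ι := Fin n)
      simpa using this
    have hKfin : μH[(n : ℝ)] K < ⊤ := by
      rw [h3, hK, volume_pi_pi]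
      simp only [Real.volume_Icc]
      exact ENNReal.prod_lt_top fun _ _ => ENNReal.ofReal_lt_top
    refine hm2.trans_lt (ENNReal.mul_lt_top ?_ (lt_of_le_of_lt hm1 (ENNReal.mul_lt_top ?_ hKfin)))
    · exact ENNReal.rpow_lt_top_of_nonneg (Nat.cast_nonneg n) ENNReal.coe_ne_top
    · exact ENNReal.rpow_lt_top_of_nonneg (Nat.cast_nonneg n) ENNReal.coe_ne_top
  refine (lt_of_le_of_lt (measure_mono hcover) (lt_of_le_of_lt (measure_iUnion_fintype_le _ _) ?_)).ne
  exact ENNReal.sum_lt_top.mpr fun p _ => hfin p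

/-- The normalized surface measure, restricted to the sphere. -/
def sph (d : ℕ) : Measure (EuclideanSpace ℝ (Fin d)) :=
  (sphereMeasure d).restrict (Metric.sphere 0 1)

lemma sph_prob {d : ℕ} (hd : 1 ≤ d) : IsProbabilityMeasure (sph d) := by
  obtain ⟨n, rfl⟩ : ∃ n, d = n + 1 := ⟨d - 1, by omega⟩
  constructor
  rw [sph, Measure.restrict_apply_univ, sphereMeasure, Measure.smul_apply, smul_eq_mul]
  have : ((n + 1 : ℕ) : ℝ) - 1 = n := by push_cast; ring
  rw [this]
  exact ENNReal.inv_mul_cancel (sphere_hausdorff_ne_zero n) (sphere_hausdorff_ne_top n)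

lemma sph_ae {d : ℕ} : ∀ᵐ η ∂(sph d), ‖η‖ = 1 := by
  rw [sph]
  filter_upwards [ae_restrict_mem (Metric.isClosed_sphere.measurableSet)] with η hη
  simpa using hη

lemma sph_integral_comp {d : ℕ} {F : Type*} [NormedAddCommGroup F] [NormedSpace ℝ F]
    (e : EuclideanSpace ℝ (Fin d) ≃ₗᵢ[ℝ] EuclideanSpace ℝ (Fin d))
    (f : EuclideanSpace ℝ (Fin d) → F) :
    ∫ η, f (e η) ∂(sph d) = ∫ η, f η ∂(sph d) := by
  have h1 : MeasurePreserving e (sphereMeasure d) (sphereMeasure d) := by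
    have := e.toIsometryEquiv.measurePreserving_hausdorffMeasure ((d : ℝ) - 1)
    exact this.smul_measure _
  have h2 := h1.setIntegral_preimage_emb e.toHomeomorph.measurableEmbedding f
    (Metric.sphere 0 1)
  have h3 : e ⁻¹' (Metric.sphere 0 1) = Metric.sphere 0 1 := by
    ext; simp
  rw [h3] at h2
  exact h2

end measure
section integrals
variable {d : ℕ}

lemma sph_bound {F : Type*} [NormedAddCommGroup F]
    {f : EuclideanSpace ℝ (Fin d) → F} (hf : Continuous f) :
    ∃ B, ∀ᵐ η ∂(sph d), ‖f η‖ ≤ B := by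
  obtain ⟨B, hB⟩ := (isCompact_sphere (0 : EuclideanSpace ℝ (Fin d)) 1).exists_bound_of_continuousOn
    hf.continuousOn
  refine ⟨B, ?_⟩
  filter_upwards [sph_ae] with η hη
  exact hB η (by simpa using hη)

lemma sph_integrable (hd : 1 ≤ d) {F : Type*} [NormedAddCommGroup F]
    [SecondCountableTopologyEither (EuclideanSpace ℝ (Fin d)) F]
    {f : EuclideanSpace ℝ (Fin d) → F} (hf : Continuous f) : Integrable f (sph d) := by
  have := sph_prob hd
  obtain ⟨B, hB⟩ := sph_bound hf
  exact Integrable.of_bound hf.aestronglyMeasurable B hB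

lemma eval_cont (Q : MvPolynomial (Fin d) ℝ) :
    Continuous (fun η : EuclideanSpace ℝ (Fin d) => eval (fun i => η i) Q) := by
  have h1 : Continuous (fun v : Fin d → ℝ => eval v Q) := MvPolynomial.continuous_eval Q
  exact h1.comp (PiLp.continuous_ofLp 2 _)

/-- Integration of polynomials over the sphere. -/
def sphInt (hd : 1 ≤ d) : MvPolynomial (Fin d) ℝ →ₗ[ℝ] ℝ where
  toFun Q := ∫ η, eval (fun i => η i) Q ∂(sph d)
  map_add' P Q := by
    simp only [map_add]
    exact integral_add (sph_integrable hd (eval_cont P)) (sph_integrable hd (eval_cont Q))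
  map_smul' c Q := by
    simp only [smul_eval, RingHom.id_apply, smul_eq_mul]
    exact integral_const_mul _ _

lemma eval_lin (x : Fin d → ℝ) (η : EuclideanSpace ℝ (Fin d)) :
    eval (fun i => η i) (lin x) = ⟪WithLp.toLp 2 x, η⟫ := by
  simp [lin, PiLp.inner_apply, mul_comm]

lemma sphInt_lin_pow (hd : 1 ≤ d) (n : ℕ) :
    ∃ K : ℝ, ∀ x : Fin d → ℝ, sphInt hd (lin x ^ n) = K * ‖WithLp.toLp 2 x‖ ^ n := by
  set e0 : EuclideanSpace ℝ (Fin d) := EuclideanSpace.single ⟨0, by omega⟩ 1 with he0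
  have he : ‖e0‖ = 1 := by simp [he0]
  refine ⟨∫ η, ⟪e0, η⟫ ^ n ∂(sph d), fun x => ?_⟩
  set x' : EuclideanSpace ℝ (Fin d) := WithLp.toLp 2 x with hx'
  have hn : ‖x'‖ = ‖(‖x'‖ • e0)‖ := by rw [norm_smul, he, norm_norm, mul_one]
  have hR := Submodule.reflection_sub hn
  set R := Submodule.reflection (ℝ ∙ (x' - ‖x'‖ • e0))ᗮ with hRdef
  change ∫ η, eval (fun i => η i) (lin x ^ n) ∂(sph d) = _
  simp only [map_pow, eval_lin]
  rw [← hx', mul_comm, ← integral_const_mul, ← sph_integral_comp R]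
  refine integral_congr_ae (Filter.Eventually.of_forall fun η => ?_)
  simp only
  rw [← mul_pow, ← real_inner_smul_left, ← hR, ← R.inner_map_map x' (R η)]
  congr 2
  exact Submodule.reflection_reflection _ η

lemma sphInt_odd (hd : 1 ≤ d) {n : ℕ} (hn : Odd n) {Q : MvPolynomial (Fin d) ℝ}
    (hQ : Q.IsHomogeneous n) : sphInt hd Q = 0 := by
  refine functional_zero _ n (fun x => ?_) hQ
  change ∫ η, eval (fun i => η i) (lin x ^ n) ∂(sph d) = 0
  simp only [map_pow, eval_lin]
  have := sph_integral_comp (LinearIsometryEquiv.neg ℝ)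
    (fun η : EuclideanSpace ℝ (Fin d) => ⟪WithLp.toLp 2 x, η⟫ ^ n)
  simp only [LinearIsometryEquiv.coe_neg, inner_neg_right, hn.neg_pow, integral_neg] at this
  linarith

lemma eval_r2 (η : EuclideanSpace ℝ (Fin d)) : eval (fun i => η i) (r2 d) = ‖η‖ ^ 2 := by
  rw [EuclideanSpace.real_norm_sq_eq]
  simp [r2, sq]

lemma prod_ne (hd : 1 ≤ d) (M : ℕ) :
    ∏ j ∈ Finset.range M, ((j : ℝ) + 1) * (4 * j + 2 * d) ≠ 0 := by
  have : (0 : ℝ) < d := by exact_mod_cast hd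
  exact Finset.prod_ne_zero_iff.mpr fun j _ => by positivity

lemma sphInt_even (hd : 1 ≤ d) (M : ℕ) {Q : MvPolynomial (Fin d) ℝ}
    (hQ : Q.IsHomogeneous (2 * M)) : sphInt hd Q = constantCoeff (lap^[M] Q) /
      ∏ j ∈ Finset.range M, ((j : ℝ) + 1) * (4 * j + 2 * d) := by
  obtain ⟨K, hK⟩ := sphInt_lin_pow hd (2 * M)
  have hf : ((2 * M).factorial : ℝ) ≠ 0 := by positivity
  have key : ∀ Q : MvPolynomial (Fin d) ℝ, Q.IsHomogeneous (2 * M) →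
      sphInt hd Q = K / (2 * M).factorial * constantCoeff (lap^[M] Q) := by
    intro Q hQ
    set T : MvPolynomial (Fin d) ℝ →ₗ[ℝ] ℝ :=
      (K / (2 * M).factorial) • ((lcoeff ℝ 0) ∘ₗ (lapLin d ^ M)) with hT
    have hTa : ∀ Q, T Q = K / (2 * M).factorial * constantCoeff (lap^[M] Q) := by
      intro Q
      simp [hT, lap_iter_eq, constantCoeff_eq]
    have := functional_zero (sphInt hd - T) (2 * M) (fun x => ?_) hQ
    · rw [LinearMap.sub_apply, hTa] at this
      linarith
    · rw [LinearMap.sub_apply, hTa, hK, lap_iter_lin_pow, constantCoeff_C, pow_mul,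
        EuclideanSpace.real_norm_sq_eq]
      field_simp
      simp
  have h1 := key (r2 d ^ M) (r2_homog.pow M)
  rw [lap_iter_r2_pow, constantCoeff_C] at h1
  have h2 : sphInt hd (r2 d ^ M) = 1 := by
    have := sph_prob hd
    change ∫ η, eval (fun i => η i) (r2 d ^ M) ∂(sph d) = 1
    rw [integral_congr_ae (g := fun _ => (1 : ℝ))]
    · simp
    · filter_upwards [sph_ae] with η hη
      simp [eval_r2, hη]
  rw [h2] at h1
  rw [key Q hQ, eq_div_iff (prod_ne hd M)]
  linear_combination (-constantCoeff (lap^[M] Q)) * h1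

lemma prod_gamma {α : ℝ} (hα0 : 0 < α) (hα : α = ((d : ℝ) - 2) / 2) (M : ℕ) :
    ∏ j ∈ Finset.range M, ((j : ℝ) + 1) * (4 * j + 2 * d) =
      4 ^ M * M.factorial * Real.Gamma (M + α + 1) / Real.Gamma (α + 1) := by
  have h0 : Real.Gamma (α + 1) ≠ 0 := (Real.Gamma_pos_of_pos (by linarith)).ne'
  induction M with
  | zero => simp [h0]
  | succ M ih =>
    rw [Finset.prod_range_succ, ih, show (d : ℝ) = 2 * α + 2 by rw [hα]; ring]
    have : Real.Gamma ((M + 1 : ℕ) + α + 1) = (M + α + 1) * Real.Gamma (M + α + 1) := by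
      rw [← Real.Gamma_add_one (by positivity)]; congr 1; push_cast; ring
    rw [this, Nat.factorial_succ]
    push_cast
    field_simp
    ring

lemma lin_homog (x : Fin d → ℝ) : (lin x).IsHomogeneous 1 :=
  IsHomogeneous.sum _ _ _ fun i _ => by
    simpa using (isHomogeneous_C _ (x i)).mul (isHomogeneous_X ℝ i)

lemma sphInt_lin_mul_harm (hd : 1 ≤ d) {α : ℝ} (hα0 : 0 < α) (hα : α = ((d : ℝ) - 2) / 2)
    (x : Fin d → ℝ) {n m M : ℕ} (hM : n + m = 2 * M) {H : MvPolynomial (Fin d) ℝ}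
    (h1 : lap H = 0) (h2 : H.IsHomogeneous m) :
    sphInt hd (lin x ^ n * H) = (M.choose m : ℝ) * n.factorial * 2 ^ m *
      (∑ i, x i ^ 2) ^ (M - m) * m.factorial * eval x H /
        (4 ^ M * M.factorial * Real.Gamma (M + α + 1) / Real.Gamma (α + 1)) := by
  have hh : (lin x ^ n * H).IsHomogeneous (2 * M) := by
    rw [← hM]
    simpa using ((lin_homog x).pow n).mul h2
  rw [sphInt_even hd M hh, lap_iter_lin_pow_mul x M n m hM H h1 h2, constantCoeff_C,
    prod_gamma hα0 hα]

lemma series (hd : 1 ≤ d) (x : EuclideanSpace ℝ (Fin d)) (H : MvPolynomial (Fin d) ℝ) :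
    HasSum (fun n : ℕ => Complex.I ^ n / (n.factorial : ℂ) *
        ((sphInt hd (lin (fun i => x i) ^ n * H) : ℝ) : ℂ))
      (∫ η, Complex.exp (Complex.I * ((⟪x, η⟫ : ℝ) : ℂ)) * ((eval (fun i => η i) H : ℝ) : ℂ)
        ∂(sph d)) := by
  have := sph_prob hd
  obtain ⟨B, hB⟩ := sph_bound (eval_cont H)
  have hterm : ∀ n : ℕ, Complex.I ^ n / (n.factorial : ℂ) *
        ((sphInt hd (lin (fun i => x i) ^ n * H) : ℝ) : ℂ) =
      ∫ η, (Complex.I * ((⟪x, η⟫ : ℝ) : ℂ)) ^ n / (n.factorial : ℂ) *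
        ((eval (fun i => η i) H : ℝ) : ℂ) ∂(sph d) := by
    intro n
    change Complex.I ^ n / (n.factorial : ℂ) *
      ((∫ η, eval (fun i => η i) (lin (fun i => x i) ^ n * H) ∂(sph d) : ℝ) : ℂ) = _
    rw [← integral_complex_ofReal, ← integral_const_mul]
    refine integral_congr_ae (Filter.Eventually.of_forall fun η => ?_)
    simp only [map_mul, map_pow, eval_lin]
    push_cast
    rw [mul_pow]
    ring
  simp only [hterm]
  have hin : Continuous fun η : EuclideanSpace ℝ (Fin d) => (((⟪x, η⟫ : ℝ) : ℂ)) := by fun_prop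
  have hH : Continuous fun η : EuclideanSpace ℝ (Fin d) => ((eval (fun i => η i) H : ℝ) : ℂ) :=
    Complex.continuous_ofReal.comp (eval_cont H)
  refine hasSum_integral_of_dominated_convergence
    (fun n _ => ‖x‖ ^ n / n.factorial * B) (fun n => ?_) (fun n => ?_) ?_ ?_ ?_
  · exact Continuous.aestronglyMeasurable (by fun_prop)
  · filter_upwards [hB, sph_ae] with η h1 h2
    rw [norm_mul, norm_div, norm_pow, norm_mul, Complex.norm_I, one_mul, Complex.norm_real,
      Complex.norm_real, Complex.norm_natCast]
    have h3 : ‖(⟪x, η⟫ : ℝ)‖ ≤ ‖x‖ := by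
      have := norm_inner_le_norm (𝕜 := ℝ) x η
      rwa [h2, mul_one] at this
    gcongr
  · exact Filter.Eventually.of_forall fun η => (Real.summable_pow_div_factorial ‖x‖).mul_right B
  · exact integrable_const _
  · refine Filter.Eventually.of_forall fun η => ?_
    rw [Complex.exp_eq_exp_ℂ]
    exact (NormedSpace.expSeries_div_hasSum_exp (Complex.I * ((⟪x, η⟫ : ℝ) : ℂ))).mul_right _

lemma bochner (hd : 1 ≤ d) {α : ℝ} (hα0 : 0 < α) (hα : α = ((d : ℝ) - 2) / 2)
    (x : EuclideanSpace ℝ (Fin d)) {m : ℕ} {H : MvPolynomial (Fin d) ℝ}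
    (h1 : lap H = 0) (h2 : H.IsHomogeneous m) :
    ∫ η, Complex.exp (Complex.I * ((⟪x, η⟫ : ℝ) : ℂ)) * ((eval (fun i => η i) H : ℝ) : ℂ)
        ∂(sph d) = (Complex.I / 2) ^ m *
      ((Real.Gamma (α + 1) / Real.Gamma (α + m + 1) * sphericalBesselJ (α + m) ‖x‖ *
        eval (fun i => x i) H : ℝ) : ℂ) := by
  rw [← (series hd x H).tsum_eq]
  have hinj : Function.Injective (fun k : ℕ => m + 2 * k) := fun a b h => by
    simp only at h; omega
  rw [← hinj.tsum_eq]
  · have hG0 : Real.Gamma (α + 1) ≠ 0 := (Real.Gamma_pos_of_pos (by linarith)).ne'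
    have hG1 : Real.Gamma (α + m + 1) ≠ 0 := (Real.Gamma_pos_of_pos (by positivity)).ne'
    have hterm : ∀ k : ℕ, Complex.I ^ (m + 2 * k) / ((m + 2 * k).factorial : ℂ) *
        ((sphInt hd (lin (fun i => x i) ^ (m + 2 * k) * H) : ℝ) : ℂ) =
        ((Complex.I / 2) ^ m * ((Real.Gamma (α + 1) * eval (fun i => x i) H : ℝ) : ℂ)) *
        (((-1) ^ k / (Real.Gamma (k + 1) * Real.Gamma (k + (α + m) + 1)) *
          (‖x‖ / 2) ^ (2 * k) : ℝ) : ℂ) := by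
      intro k
      rw [sphInt_lin_mul_harm hd hα0 hα _ (show m + 2 * k + m = 2 * (m + k) by ring) h1 h2,
        Nat.add_sub_cancel_left, pow_add Complex.I, pow_mul, Complex.I_sq, div_pow,
        ← EuclideanSpace.real_norm_sq_eq, Real.Gamma_nat_eq_factorial,
        show (k : ℝ) + (α + m) + 1 = ((m + k : ℕ) : ℝ) + α + 1 by push_cast; ring]
      have hG2 : Real.Gamma (((m + k : ℕ) : ℝ) + α + 1) ≠ 0 :=
        (Real.Gamma_pos_of_pos (by positivity)).ne'
      have hch : (((m + k).choose m : ℕ) : ℂ) * m.factorial * k.factorial = (m + k).factorial := by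
        have := Nat.choose_mul_factorial_mul_factorial (Nat.le_add_right m k)
        rw [Nat.add_sub_cancel_left] at this
        exact_mod_cast this
      have hf1 : ((m + 2 * k).factorial : ℂ) ≠ 0 := by exact_mod_cast (Nat.factorial_pos _).ne'
      have hf2 : ((m + k).factorial : ℂ) ≠ 0 := by exact_mod_cast (Nat.factorial_pos _).ne'
      have hf3 : (k.factorial : ℂ) ≠ 0 := by exact_mod_cast (Nat.factorial_pos _).ne'
      have hG0' : ((Real.Gamma (α + 1) : ℝ) : ℂ) ≠ 0 := by exact_mod_cast hG0
      have hG2' : ((Real.Gamma (((m + k : ℕ) : ℝ) + α + 1) : ℝ) : ℂ) ≠ 0 := by exact_mod_cast hG2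
      generalize Real.Gamma (((m + k : ℕ) : ℝ) + α + 1) = G2 at *
      generalize Real.Gamma (α + 1) = G0 at *
      have h4 : (4 : ℂ) ^ (m + k) = 2 ^ m * 2 ^ m * 2 ^ (2 * k) := by
        rw [show (4 : ℂ) = 2 ^ 2 by norm_num, ← pow_mul, ← pow_add, ← pow_add]
        congr 1; ring
      push_cast
      rw [h4, ← hch, div_pow, pow_mul (‖x‖ : ℂ)]
      have hf4 : (((m + k).choose m : ℕ) : ℂ) ≠ 0 := by
        exact_mod_cast (Nat.choose_pos (Nat.le_add_right m k)).ne'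
      have hf5 : (m.factorial : ℂ) ≠ 0 := by exact_mod_cast (Nat.factorial_pos _).ne'
      field_simp
    rw [tsum_congr hterm, tsum_mul_left, ← Complex.ofReal_tsum, mul_assoc, ← Complex.ofReal_mul,
      sphericalBesselJ]
    congr 2
    field_simp
  · intro n hn
    by_contra hnot
    apply hn
    beta_reduce
    rcases Nat.even_or_odd (n + m) with he | ho
    · obtain ⟨M, hM⟩ := he
      have hlt : M < m := by
        by_contra hle
        exact hnot ⟨M - m, by simp only; omega⟩
      rw [sphInt_lin_mul_harm hd hα0 hα _ (show n + m = 2 * M by omega) h1 h2,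
        Nat.choose_eq_zero_of_lt hlt]
      simp
    · rw [sphInt_odd hd ho (by simpa using ((lin_homog _).pow n).mul h2)]
      simp

end integrals

/-- **Fourier transform of the measure `P(ξ)dσ(ξ)` on the unit sphere, first form
(Theorem 3, equation (11)).** For a homogeneous polynomial `P` of degree `l` on `ℝ^d`
(`d ≥ 3`, `α = (d-2)/2`):
`∫_{S^{d-1}} e^{i(x|η)} P(η) dσ(η)
  = (i/2)^l Σ_{k=0}^{⌊l/2⌋} (-1)^k 2^{2k} Γ(α+1)/Γ(α+l+1-2k) j_{α+l-2k}(|x|) h_{l-2k}(P)(x)`. -/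
theorem fourier_transform_sphere_first_form (d l : ℕ) (hd : 3 ≤ d)
    (α : ℝ) (hα : α = ((d : ℝ) - 2) / 2)
    (P : MvPolynomial (Fin d) ℝ) (hP : P.IsHomogeneous l)
    (x : EuclideanSpace ℝ (Fin d)) :
    ∫ η in Metric.sphere (0 : EuclideanSpace ℝ (Fin d)) 1,
        Complex.exp (Complex.I * ((⟪x, η⟫ : ℝ) : ℂ)) * ((eval (fun i => η i) P : ℝ) : ℂ)
        ∂(sphereMeasure d) =
      (Complex.I / 2) ^ l *
        ∑ k ∈ Finset.range (l / 2 + 1),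
          (((-1 : ℝ) ^ k * 2 ^ (2 * k) * Real.Gamma (α + 1) / Real.Gamma (α + l + 1 - 2 * k) *
              sphericalBesselJ (α + l - 2 * k) ‖x‖ *
              eval (fun i => x i) (harmComp d α l k P) : ℝ) : ℂ) := by
  have hd1 : 1 ≤ d := by omega
  have hα0 : 0 < α := by
    have : (3 : ℝ) ≤ d := by exact_mod_cast hd
    rw [hα]; linarith
  change ∫ η, _ ∂(sph d) = _
  have hdec : ∀ᵐ η ∂(sph d),
      Complex.exp (Complex.I * ((⟪x, η⟫ : ℝ) : ℂ)) * ((eval (fun i => η i) P : ℝ) : ℂ) =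
      ∑ k ∈ Finset.range (l / 2 + 1), Complex.exp (Complex.I * ((⟪x, η⟫ : ℝ) : ℂ)) *
        ((eval (fun i => η i) (harmComp d α l k P) : ℝ) : ℂ) := by
    filter_upwards [sph_ae] with η hη
    conv_lhs => rw [← harmComp_sum hα0 l P]
    rw [map_sum, Complex.ofReal_sum, Finset.mul_sum]
    refine Finset.sum_congr rfl fun k _ => ?_
    rw [map_mul, map_pow, eval_r2, hη]
    simp
  rw [integral_congr_ae hdec, integral_finsetSum]
  · rw [Finset.mul_sum]
    refine Finset.sum_congr rfl fun k hk => ?_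
    rw [Finset.mem_range] at hk
    have hk' : 2 * k ≤ l := by omega
    rw [bochner hd1 hα0 hα x (harmComp_harm hα0 hα (by omega) hP) (harmComp_homog (by omega) hP)]
    have hpow : (Complex.I / 2) ^ l = (Complex.I / 2) ^ (l - 2 * k) * ((-1) ^ k / 2 ^ (2 * k)) := by
      conv_lhs => rw [← Nat.sub_add_cancel hk']
      rw [pow_add, pow_mul (Complex.I / 2) 2 k, div_pow Complex.I 2 2, Complex.I_sq, div_pow (-1) _ k,
        pow_mul (2 : ℂ)]
    rw [hpow, mul_assoc ((Complex.I / 2) ^ (l - 2 * k)), Nat.cast_sub hk']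
    congr 1
    push_cast
    rw [show α + (l - 2 * k : ℝ) = α + l - 2 * k by ring,
      show α + l - 2 * k + 1 = α + l + 1 - 2 * (k : ℝ) by ring]
    have hs : ((-1 : ℂ)) ^ k * (-1) ^ k = 1 := by rw [← mul_pow]; simp
    have h2 : (2 : ℂ) ^ (2 * k) ≠ 0 := pow_ne_zero _ two_ne_zero
    field_simp
    linear_combination (-(Real.Gamma (α + 1) : ℂ) * (sphericalBesselJ (α + l - 2 * k) ‖x‖) *
      ((eval (fun i => x i) (harmComp d α l k P) : ℝ) : ℂ) / (Real.Gamma (α + l + 1 - 2 * k))) * hs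
  · intro k _
    refine sph_integrable hd1 ?_
    have hH : Continuous fun η : EuclideanSpace ℝ (Fin d) =>
        ((eval (fun i => η i) (harmComp d α l k P) : ℝ) : ℂ) :=
      Complex.continuous_ofReal.comp (eval_cont _)
    have hin : Continuous fun η : EuclideanSpace ℝ (Fin d) => (((⟪x, η⟫ : ℝ) : ℂ)) := by fun_prop
    fun_prop

end
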